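/- arXiv:2305.04367 — 9 statements merged into one kernel-verified Lean document; each statement's English description precedes it below -/
import Mathlib

section
/- Assume dim V ≥ 2. Then for every N > 0, the image of the sphere S(N) = {u ∈ V : ‖u‖ = N} under the second slow roll function η∥ is exactly the closed interval [1 − 1/c_m(N), 1 + 1/c_m(N)], where c_m(N) = N·√(N² + 2Φ0)/(M0·‖g‖). In particular, for every ε in this interval there exists u ∈ V with ‖u‖ = N and η∥(u) = ε. -/
open scoped RealInnerProductSpace

variable {V : Type*} [NormedAddCommGroup V] [InnerProductSpace ℝ V] [FiniteDimensional ℝ V]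

/-- The rescaled Hubble function `H(u) = (1/M0)·√(‖u‖² + 2Φ0)`. -/
noncomputable def Hfun (M0 Φ0 : ℝ) (u : V) : ℝ := (1 / M0) * Real.sqrt (‖u‖ ^ 2 + 2 * Φ0)

/-- The rescaled tangential acceleration (second slow roll) function
`η∥(u) = 1 + ⟨g,u⟩/(H(u)·‖u‖²)`. -/
noncomputable def etaPar (M0 Φ0 : ℝ) (g u : V) : ℝ :=
  1 + ⟪g, u⟫ / (Hfun M0 Φ0 u * ‖u‖ ^ 2)

/-- The conservative function evaluated on vectors of norm `N`:
`c_m(N) = N·√(N² + 2Φ0)/(M0·‖g‖)`. -/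
noncomputable def consNorm (M0 Φ0 normg N : ℝ) : ℝ :=
  N * Real.sqrt (N ^ 2 + 2 * Φ0) / (M0 * normg)

/-- In dimension at least two, `⟪g, ·⟫` maps the sphere of radius `r` centred at the origin onto
the interval allowed by the Cauchy–Schwarz inequality. -/
theorem image_inner_sphere {E : Type*} [NormedAddCommGroup E] [InnerProductSpace ℝ E]
    (h : 1 < Module.rank ℝ E) {g : E} (hg : g ≠ 0) {r : ℝ} (hr : 0 ≤ r) :
    (fun u : E => ⟪g, u⟫) '' Metric.sphere 0 r = Set.Icc (-(‖g‖ * r)) (‖g‖ * r) := by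
  have hg' : ‖g‖ ≠ 0 := norm_ne_zero_iff.mpr hg
  apply Set.Subset.antisymm
  · rintro _ ⟨u, hu, rfl⟩
    rw [mem_sphere_zero_iff_norm] at hu
    simpa only [hu, abs_le, Set.mem_Icc] using abs_real_inner_le_norm g u
  · have hmem : ∀ s : ℝ, |s| = r → (s / ‖g‖) • g ∈ Metric.sphere (0 : E) r := fun s hs => by
      rw [mem_sphere_zero_iff_norm, norm_smul, Real.norm_eq_abs, abs_div, abs_norm, hs,
        div_mul_cancel₀ _ hg']
    have hval : ∀ s : ℝ, ⟪g, (s / ‖g‖) • g⟫ = ‖g‖ * s := fun s => by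
      rw [real_inner_smul_right, real_inner_self_eq_norm_sq]
      field_simp
    have := (isPreconnected_sphere h (0 : E) r).intermediate_value
      (hmem (-r) (by rw [abs_neg, abs_of_nonneg hr])) (hmem r (abs_of_nonneg hr))
      (f := fun u : E => ⟪g, u⟫) (by fun_prop)
    simpa only [hval, mul_neg] using this

/-- On vectors of norm `N`, `η∥` is an affine function of the normalized inner product. -/
theorem etaPar_eq_of_norm_eq {E : Type*} [NormedAddCommGroup E] [InnerProductSpace ℝ E]
    {M0 Φ0 N : ℝ} {g u : E} (hg : g ≠ 0) (hN : N ≠ 0) (hu : ‖u‖ = N) :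
    etaPar M0 Φ0 g u = 1 + ⟪g, u⟫ / (‖g‖ * N) * (1 / consNorm M0 Φ0 ‖g‖ N) := by
  have hg' : ‖g‖ ≠ 0 := norm_ne_zero_iff.mpr hg
  rw [etaPar, Hfun, consNorm, hu]
  field_simp

/-- If `dim V ≥ 2`, the image of the sphere of radius `N > 0` under the second slow
roll function `η∥` is exactly the closed interval `[1 − 1/c_m(N), 1 + 1/c_m(N)]`;
in particular every value in this interval is attained on the sphere. -/
theorem etaPar_image_sphere (M0 Φ0 : ℝ) (hM0 : 0 < M0) (hΦ0 : 0 < Φ0)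
    (g : V) (hg : g ≠ 0) (hdim : 2 ≤ Module.finrank ℝ V) (N : ℝ) (hN : 0 < N) :
    (fun u : V => etaPar M0 Φ0 g u) '' {u : V | ‖u‖ = N} =
      Set.Icc (1 - 1 / consNorm M0 Φ0 ‖g‖ N) (1 + 1 / consNorm M0 Φ0 ‖g‖ N) ∧
    ∀ ε ∈ Set.Icc (1 - 1 / consNorm M0 Φ0 ‖g‖ N) (1 + 1 / consNorm M0 Φ0 ‖g‖ N),
      ∃ u : V, ‖u‖ = N ∧ etaPar M0 Φ0 g u = ε := by
  have hgpos : 0 < ‖g‖ := norm_pos_iff.mpr hg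
  have hgN : 0 < ‖g‖ * N := mul_pos hgpos hN
  have hc : 0 < consNorm M0 Φ0 ‖g‖ N := by
    unfold consNorm
    positivity
  have hrank : 1 < Module.rank ℝ V := by
    rw [← Module.finrank_eq_rank]
    exact_mod_cast hdim
  have hinner := image_inner_sphere hrank hg hN.le
  have himage : (fun u : V => etaPar M0 Φ0 g u) '' {u : V | ‖u‖ = N} =
      Set.Icc (1 - 1 / consNorm M0 Φ0 ‖g‖ N) (1 + 1 / consNorm M0 Φ0 ‖g‖ N) := by
    ext ε
    constructor
    · rintro ⟨u, hu, rfl⟩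
      have hmem : ⟪g, u⟫ ∈ Set.Icc (-(‖g‖ * N)) (‖g‖ * N) :=
        hinner ▸ Set.mem_image_of_mem _ (mem_sphere_zero_iff_norm.mpr hu)
      have hlo : -1 ≤ ⟪g, u⟫ / (‖g‖ * N) := by
        rw [le_div_iff₀ hgN]
        linarith [hmem.1]
      have hhi : ⟪g, u⟫ / (‖g‖ * N) ≤ 1 := (div_le_one hgN).mpr hmem.2
      have hinv := one_div_pos.mpr hc
      simp only [etaPar_eq_of_norm_eq hg hN.ne' hu]
      constructor <;> nlinarith
    · rintro ⟨hlo, hhi⟩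
      have hle : |(ε - 1) * consNorm M0 Φ0 ‖g‖ N| ≤ 1 := by
        rw [abs_mul, abs_of_pos hc, ← le_div_iff₀ hc, abs_le]
        constructor <;> linarith
      have hmem : (ε - 1) * consNorm M0 Φ0 ‖g‖ N * (‖g‖ * N) ∈
          Set.Icc (-(‖g‖ * N)) (‖g‖ * N) := by
        rw [abs_le] at hle
        constructor <;> nlinarith
      rw [← hinner] at hmem
      obtain ⟨u, hu, hgu⟩ := hmem
      rw [mem_sphere_zero_iff_norm] at hu
      refine ⟨u, hu, ?_⟩
      simp only at hgu ⊢
      rw [etaPar_eq_of_norm_eq hg hN.ne' hu, hgu, mul_div_cancel_right₀ _ hgN.ne', mul_one_div,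
        mul_div_cancel_right₀ _ hc.ne']
      ring
  exact ⟨himage, fun ε hε => himage.superset hε⟩
end

section
/- Assume dim V ≥ 2 and set A₁ = √(−Φ0 + √(Φ0² + M0²·‖g‖²)). Then for every real N with 0 < N ≤ A₁ there exists a vector u ∈ V with ‖u‖ = N and η∥(u) = 0 (i.e. the no-roll shell meets every sphere of radius at most A₁). -/
open scoped RealInnerProductSpace

variable {V : Type*} [NormedAddCommGroup V] [InnerProductSpace ℝ V] [FiniteDimensional ℝ V]

/-- In dimension at least two, the inner product with `g` takes on the sphere of radius `r`
every value allowed by the Cauchy–Schwarz inequality. -/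
theorem exists_norm_eq_inner_eq {E : Type*} [NormedAddCommGroup E] [InnerProductSpace ℝ E]
    (hE : 1 < Module.rank ℝ E) {g : E} (hg : g ≠ 0) {r c : ℝ} (hr : 0 ≤ r)
    (hc : |c| ≤ ‖g‖ * r) : ∃ u : E, ‖u‖ = r ∧ ⟪g, u⟫ = c := by
  have hg' : ‖g‖ ≠ 0 := norm_ne_zero_iff.mpr hg
  have hnorm : ‖(r / ‖g‖) • g‖ = r := by
    rw [norm_smul, Real.norm_of_nonneg (by positivity), div_mul_cancel₀ _ hg']
  have hinner : ⟪g, (r / ‖g‖) • g⟫ = ‖g‖ * r := by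
    rw [real_inner_smul_right, real_inner_self_eq_norm_sq]
    field_simp
  obtain ⟨u, hu, huc⟩ := (isPreconnected_sphere hE (0 : E) r).intermediate_value
    (a := -((r / ‖g‖) • g)) (b := (r / ‖g‖) • g) (by simpa using hnorm) (by simpa using hnorm)
    (f := fun u => ⟪g, u⟫) (by fun_prop)
    (show c ∈ Set.Icc ⟪g, -((r / ‖g‖) • g)⟫ ⟪g, (r / ‖g‖) • g⟫ by
      rw [inner_neg_right, hinner]
      exact abs_le.mp hc)
  exact ⟨u, by simpa using hu, huc⟩

/-- The bound on the radius in the form needed for the Cauchy–Schwarz inequality. -/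
theorem sqrt_sq_add_mul_le {M Φ G N : ℝ} (hM : 0 ≤ M) (hΦ : 0 ≤ Φ) (hG : 0 ≤ G) (hN : 0 < N)
    (h : N ≤ √(-Φ + √(Φ ^ 2 + M ^ 2 * G ^ 2))) : √(N ^ 2 + 2 * Φ) * N ≤ M * G := by
  have h₁ : N ^ 2 ≤ -Φ + √(Φ ^ 2 + M ^ 2 * G ^ 2) := (Real.le_sqrt' hN).mp h
  have h₂ : (N ^ 2 + Φ) ^ 2 ≤ Φ ^ 2 + M ^ 2 * G ^ 2 :=
    (Real.le_sqrt' (by positivity)).mp (by linarith)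
  refine abs_le_of_sq_le_sq' ?_ (by positivity) |>.2
  rw [mul_pow, Real.sq_sqrt (by positivity)]
  linarith

/-- If `dim V ≥ 2` and `A₁ = √(−Φ0 + √(Φ0² + M0²·‖g‖²))`, then for every `N` with
`0 < N ≤ A₁` there is a vector `u` with `‖u‖ = N` lying on the no-roll shell
`η∥(u) = 0`. -/
theorem noRollShell_meets_spheres (M0 Φ0 : ℝ) (hM0 : 0 < M0) (hΦ0 : 0 < Φ0)
    (g : V) (hg : g ≠ 0) (hdim : 2 ≤ Module.finrank ℝ V) :
    ∀ N : ℝ, 0 < N →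
      N ≤ Real.sqrt (-Φ0 + Real.sqrt (Φ0 ^ 2 + M0 ^ 2 * ‖g‖ ^ 2)) →
      ∃ u : V, ‖u‖ = N ∧ etaPar M0 Φ0 g u = 0 := by
  intro N hN hle
  have hrank : 1 < Module.rank ℝ V := by
    rw [← Module.finrank_eq_rank]
    exact_mod_cast hdim
  have hs : 0 < √(N ^ 2 + 2 * Φ0) := by positivity
  have hbound : 1 / M0 * √(N ^ 2 + 2 * Φ0) * N ≤ ‖g‖ := by
    rw [mul_assoc, one_div, inv_mul_le_iff₀ hM0]
    exact sqrt_sq_add_mul_le hM0.le hΦ0.le (norm_nonneg g) hN hle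
  obtain ⟨u, hu, hgu⟩ := exists_norm_eq_inner_eq hrank hg hN.le
    (c := -(1 / M0 * √(N ^ 2 + 2 * Φ0) * N ^ 2)) (by
      rw [abs_neg, abs_of_nonneg (by positivity), pow_two N, ← mul_assoc, ← pow_two N]
      exact mul_le_mul_of_nonneg_right hbound hN.le)
  refine ⟨u, hu, ?_⟩
  rw [etaPar, Hfun, hgu, hu, neg_div, div_self (by positivity), add_neg_cancel]
end

section
/- Set A₁ = √(−Φ0 + √(Φ0² + M0²·‖g‖²)). Then for N = A₁ the equation η∥(u) = 0 with ‖u‖ = N has the unique solution u = −N·g/‖g‖; i.e. the intersection of the no-roll shell with the sphere of radius A₁ is reduced to a single point. -/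
open scoped RealInnerProductSpace

variable {V : Type*} [NormedAddCommGroup V] [InnerProductSpace ℝ V] [FiniteDimensional ℝ V]

theorem etaPar_eq_zero_iff_of_hubble_mul_norm {V : Type*} [NormedAddCommGroup V]
    [InnerProductSpace ℝ V] {M0 Φ0 : ℝ} {g u : V} (hg : g ≠ 0) (hu : u ≠ 0)
    (h : Hfun M0 Φ0 u * ‖u‖ = ‖g‖) :
    etaPar M0 Φ0 g u = 0 ↔ u = -((‖u‖ / ‖g‖) • g) := by
  have hG : 0 < ‖g‖ := norm_pos_iff.mpr hg
  have hU : 0 < ‖u‖ := norm_pos_iff.mpr hu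
  have hH : Hfun M0 Φ0 u * ‖u‖ ^ 2 = ‖g‖ * ‖u‖ := by rw [← h]; ring
  have h_eta : etaPar M0 Φ0 g u = 0 ↔ ⟪-g, u⟫ = ‖-g‖ * ‖u‖ := by
    rw [etaPar, hH, inner_neg_left, norm_neg]
    field_simp
    constructor <;> intro h0 <;> linarith
  rw [h_eta, inner_eq_norm_mul_iff_real, norm_neg, eq_comm, ← eq_inv_smul_iff₀ hG.ne',
    smul_smul, smul_neg, mul_comm, ← div_eq_mul_inv]

/-- The radius `A₁` is the positive solution of `A²(A² + 2Φ0) = M0²G²`. -/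
theorem sqrt_neg_add_sqrt_pos_and_eq {M0 Φ0 G : ℝ} (hM0 : 0 < M0) (hΦ0 : 0 < Φ0) (hG : 0 < G) :
    0 < √(-Φ0 + √(Φ0 ^ 2 + M0 ^ 2 * G ^ 2)) ∧
      1 / M0 * √(√(-Φ0 + √(Φ0 ^ 2 + M0 ^ 2 * G ^ 2)) ^ 2 + 2 * Φ0) *
        √(-Φ0 + √(Φ0 ^ 2 + M0 ^ 2 * G ^ 2)) = G := by
  have hMG : 0 < M0 ^ 2 * G ^ 2 := by positivity
  have hlt : 0 < -Φ0 + √(Φ0 ^ 2 + M0 ^ 2 * G ^ 2) := by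
    have := Real.lt_sqrt_of_sq_lt (lt_add_of_pos_right (Φ0 ^ 2) hMG)
    linarith
  refine ⟨Real.sqrt_pos.mpr hlt, ?_⟩
  have hS := Real.sq_sqrt (show 0 ≤ Φ0 ^ 2 + M0 ^ 2 * G ^ 2 by positivity)
  rw [Real.sq_sqrt hlt.le, mul_assoc, ← Real.sqrt_mul (by linarith),
    show ((-Φ0 + √(Φ0 ^ 2 + M0 ^ 2 * G ^ 2)) + 2 * Φ0) * (-Φ0 + √(Φ0 ^ 2 + M0 ^ 2 * G ^ 2)) =
      (M0 * G) ^ 2 by linear_combination hS, Real.sqrt_sq (by positivity)]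
  field_simp

/-- With `A₁ = √(−Φ0 + √(Φ0² + M0²·‖g‖²))`, the equation `η∥(u) = 0` with `‖u‖ = A₁`
has the unique solution `u = −A₁·g/‖g‖`: the intersection of the no-roll shell with
the sphere of radius `A₁` is a single point. -/
theorem noRollShell_sphere_A1_unique (M0 Φ0 : ℝ) (hM0 : 0 < M0) (hΦ0 : 0 < Φ0)
    (g : V) (hg : g ≠ 0) :
    ∀ u : V,
      (‖u‖ = Real.sqrt (-Φ0 + Real.sqrt (Φ0 ^ 2 + M0 ^ 2 * ‖g‖ ^ 2)) ∧
        etaPar M0 Φ0 g u = 0) ↔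
      u = -((Real.sqrt (-Φ0 + Real.sqrt (Φ0 ^ 2 + M0 ^ 2 * ‖g‖ ^ 2)) / ‖g‖) • g) := by
  intro u
  have hG : 0 < ‖g‖ := norm_pos_iff.mpr hg
  obtain ⟨hA, hH⟩ := sqrt_neg_add_sqrt_pos_and_eq hM0 hΦ0 hG
  set A := √(-Φ0 + √(Φ0 ^ 2 + M0 ^ 2 * ‖g‖ ^ 2))
  have key (hu : ‖u‖ = A) : etaPar M0 Φ0 g u = 0 ↔ u = -((A / ‖g‖) • g) := by
    have hu0 : u ≠ 0 := norm_pos_iff.mp (hu ▸ hA)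
    rw [etaPar_eq_zero_iff_of_hubble_mul_norm hg hu0 (by rw [Hfun, hu, hH]), hu]
  refine ⟨fun h ↦ (key h.1).mp h.2, fun h ↦ ?_⟩
  have hu : ‖u‖ = A := by
    rw [h, norm_neg, norm_smul, Real.norm_of_nonneg (by positivity), div_mul_cancel₀ _ hG.ne']
  exact ⟨hu, (key hu).mpr h⟩
end

section
/- Set A₁ = √(−Φ0 + √(Φ0² + M0²·‖g‖²)). Then for every N > A₁ there is no vector u ∈ V with ‖u‖ = N and η∥(u) = 0; i.e. the no-roll shell does not intersect spheres of radius larger than A₁. -/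
open scoped RealInnerProductSpace

variable {V : Type*} [NormedAddCommGroup V] [InnerProductSpace ℝ V] [FiniteDimensional ℝ V]

/-- With `A₁ = √(−Φ0 + √(Φ0² + M0²·‖g‖²))`, for every `N > A₁` there is no vector
`u` with `‖u‖ = N` and `η∥(u) = 0`: the no-roll shell does not intersect spheres of
radius larger than `A₁`. -/
theorem noRollShell_misses_large_spheres (M0 Φ0 : ℝ) (hM0 : 0 < M0) (hΦ0 : 0 < Φ0)
    (g : V) (hg : g ≠ 0) :
    ∀ N : ℝ, Real.sqrt (-Φ0 + Real.sqrt (Φ0 ^ 2 + M0 ^ 2 * ‖g‖ ^ 2)) < N →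
      ¬∃ u : V, ‖u‖ = N ∧ etaPar M0 Φ0 g u = 0 := by
  rintro N hN ⟨u, rfl, hη⟩
  have hu : 0 < ‖u‖ := (Real.sqrt_nonneg _).trans_lt hN
  have hrad : 0 < ‖u‖ ^ 2 + 2 * Φ0 := by positivity
  have hlarge : M0 ^ 2 * ‖g‖ ^ 2 < ‖u‖ ^ 2 * (‖u‖ ^ 2 + 2 * Φ0) := by
    have h := (Real.sqrt_lt' hu).1 hN
    have h' : Real.sqrt (Φ0 ^ 2 + M0 ^ 2 * ‖g‖ ^ 2) < ‖u‖ ^ 2 + Φ0 := by linarith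
    have h'' := (Real.sqrt_lt' (by positivity)).1 h'
    linarith
  have hH : 0 < Hfun M0 Φ0 u := by
    unfold Hfun
    positivity
  have hroot : -⟪g, u⟫ = Hfun M0 Φ0 u * ‖u‖ ^ 2 := by
    unfold etaPar at hη
    field_simp at hη
    linarith
  have hle : Hfun M0 Φ0 u * ‖u‖ ≤ ‖g‖ := by
    refine le_of_mul_le_mul_right ?_ hu
    have h := (neg_le_abs _).trans (abs_real_inner_le_norm g u)
    linarith
  have hsq : (M0 * Hfun M0 Φ0 u) ^ 2 = ‖u‖ ^ 2 + 2 * Φ0 := by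
    rw [Hfun, ← mul_assoc, mul_one_div_cancel hM0.ne', one_mul, Real.sq_sqrt hrad.le]
  have hsmall : (M0 * (Hfun M0 Φ0 u * ‖u‖)) ^ 2 ≤ (M0 * ‖g‖) ^ 2 := by gcongr
  rw [← hsq] at hlarge
  linarith
end

section
/- Assume dim V ≥ 2. Then for all parameters ε₁, ε₃ ∈ (0,1] there exists a nonzero vector u ∈ V satisfying simultaneously the slow roll conservative conditions κ(u) < ε₁, η∥(u) = 0 and c(u) < ε₃. In particular the slow roll conservative region projects onto every noncritical point of the scalar manifold. -/
open scoped RealInnerProductSpace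

variable {V : Type*} [NormedAddCommGroup V] [InnerProductSpace ℝ V] [FiniteDimensional ℝ V]

/-- The first IR function `κ(u) = ‖u‖²/(2Φ0)`. -/
noncomputable def kappa (Φ0 : ℝ) (u : V) : ℝ := ‖u‖ ^ 2 / (2 * Φ0)

/-- The conservative function `c(u) = ‖u‖·√(‖u‖² + 2Φ0)/(M0·‖g‖)`. -/
noncomputable def cons (M0 Φ0 : ℝ) (g u : V) : ℝ :=
  ‖u‖ * Real.sqrt (‖u‖ ^ 2 + 2 * Φ0) / (M0 * ‖g‖)

/-- In dimension at least two, a vector can be chosen with any prescribed norm `r` and any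
inner product `p` with a given nonzero vector that is compatible with Cauchy–Schwarz. -/
theorem exists_norm_eq_and_inner_eq {g : V} (hg : g ≠ 0) (hdim : 2 ≤ Module.finrank ℝ V)
    {r p : ℝ} (hr : 0 ≤ r) (hp : |p| ≤ ‖g‖ * r) : ∃ u : V, ‖u‖ = r ∧ ⟪g, u⟫ = p := by
  have hfin := (Submodule.span ℝ {g}).finrank_add_finrank_orthogonal
  rw [finrank_span_singleton hg] at hfin
  have : Nontrivial (Submodule.span ℝ {g})ᗮ :=
    Module.nontrivial_of_finrank_pos (R := ℝ) (by omega)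
  have hg' : 0 < ‖g‖ := norm_pos_iff.mpr hg
  have hs : 0 ≤ r ^ 2 - (p / ‖g‖) ^ 2 := by
    have : |p / ‖g‖| ≤ r := by
      rw [abs_div, abs_norm, div_le_iff₀ hg']
      linarith
    have := sq_le_sq' (neg_le_of_abs_le this) (le_of_abs_le this)
    linarith
  obtain ⟨⟨w, hw⟩, hwn⟩ := exists_norm_eq (Submodule.span ℝ {g})ᗮ
    (Real.sqrt_nonneg (r ^ 2 - (p / ‖g‖) ^ 2))
  rw [Submodule.coe_norm] at hwn
  have hgw : ⟪g, w⟫ = 0 := Submodule.mem_orthogonal_singleton_iff_inner_right.mp hw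
  refine ⟨(p / ‖g‖ ^ 2) • g + w, ?_, ?_⟩
  · rw [← sq_eq_sq₀ (norm_nonneg _) hr, norm_add_sq_real, real_inner_smul_left, hgw, hwn,
      Real.sq_sqrt hs, norm_smul, mul_pow, Real.norm_eq_abs, sq_abs]
    field_simp
    ring
  · rw [inner_add_right, real_inner_smul_right, hgw, real_inner_self_eq_norm_sq]
    field_simp
    ring

/-- If `dim V ≥ 2`, then for all parameters `ε₁, ε₃ ∈ (0,1]` there is a nonzero
vector `u` satisfying the slow roll conservative conditions
`κ(u) < ε₁`, `η∥(u) = 0` and `c(u) < ε₃`. -/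
theorem slowRollConservative_nonempty (M0 Φ0 : ℝ) (hM0 : 0 < M0) (hΦ0 : 0 < Φ0)
    (g : V) (hg : g ≠ 0) (hdim : 2 ≤ Module.finrank ℝ V) :
    ∀ ε₁ ∈ Set.Ioc (0 : ℝ) 1, ∀ ε₃ ∈ Set.Ioc (0 : ℝ) 1,
      ∃ u : V, u ≠ 0 ∧ kappa Φ0 u < ε₁ ∧ etaPar M0 Φ0 g u = 0 ∧
        cons M0 Φ0 g u < ε₃ := by
  rintro ε₁ ⟨hε₁, -⟩ ε₃ ⟨hε₃, hε₃'⟩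
  have hg' : 0 < ‖g‖ := norm_pos_iff.mpr hg
  have small {f : ℝ → ℝ} (hf : Continuous f) (h0 : f 0 = 0) {ε : ℝ} (hε : 0 < ε) :
      ∀ᶠ r in nhdsWithin 0 (Set.Ioi 0), f r < ε :=
    hf.continuousWithinAt.eventually_lt_const (by rwa [h0])
  obtain ⟨r, hr, hκ, hc⟩ := (eventually_mem_nhdsWithin.and
    ((small (f := fun r ↦ r ^ 2 / (2 * Φ0)) (by fun_prop) (by simp) hε₁).and
      (small (f := fun r ↦ r * Real.sqrt (r ^ 2 + 2 * Φ0) / (M0 * ‖g‖))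
        (by fun_prop) (by simp) hε₃))).exists
  replace hr : 0 < r := hr
  have hS : 0 < Real.sqrt (r ^ 2 + 2 * Φ0) := Real.sqrt_pos.mpr (by positivity)
  obtain ⟨u, hu, hgu⟩ := exists_norm_eq_and_inner_eq hg hdim (r := r)
    (p := -(1 / M0 * Real.sqrt (r ^ 2 + 2 * Φ0) * r ^ 2)) hr.le (by
      have h := hc.le.trans hε₃'
      rw [div_le_one (by positivity)] at h
      rw [abs_neg, abs_of_pos (by positivity)]
      calc 1 / M0 * Real.sqrt (r ^ 2 + 2 * Φ0) * r ^ 2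
          = r * Real.sqrt (r ^ 2 + 2 * Φ0) * (r / M0) := by ring
        _ ≤ M0 * ‖g‖ * (r / M0) := by gcongr
        _ = ‖g‖ * r := by field_simp)
  refine ⟨u, norm_pos_iff.mp (hu ▸ hr), ?_, ?_, ?_⟩
  · rwa [kappa, hu]
  · rw [etaPar, Hfun, hu, hgu, neg_div, div_self (by positivity), add_neg_cancel]
  · rwa [cons, hu]
end

section
/- Let u ∈ V be nonzero with η∥(u) ≠ 1 (equivalently cosθ(u) ≠ 0). Then the norm of u is determined by η∥(u) and θ(u) through ‖u‖² = Φ0·(−1 + √(1 + 4·‖Ξ‖²·cos²θ(u)/(η∥(u) − 1)²)), where ‖Ξ‖ = M0·‖g‖/(2Φ0). Consequently, fixing the value of η∥ constrains u to lie on a hypersurface of revolution around the axis determined by g. -/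
open scoped RealInnerProductSpace

variable {V : Type*} [NormedAddCommGroup V] [InnerProductSpace ℝ V] [FiniteDimensional ℝ V]

/-- The characteristic angle function via `cosθ(u) = ⟨u,g⟩/(‖u‖·‖g‖)`. -/
noncomputable def cosTheta (g u : V) : ℝ := ⟪u, g⟫ / (‖u‖ * ‖g‖)

/-- The norm of the characteristic one-form, `‖Ξ‖ = M0·‖g‖/(2Φ0)`. -/
noncomputable def XiNorm (M0 Φ0 : ℝ) (g : V) : ℝ := M0 * ‖g‖ / (2 * Φ0)

/-- For nonzero `u` with `η∥(u) ≠ 1` (equivalently `cosθ(u) ≠ 0`), the norm of `u`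
is determined by `η∥(u)` and `θ(u)` through
`‖u‖² = Φ0·(−1 + √(1 + 4·‖Ξ‖²·cos²θ(u)/(η∥(u) − 1)²))`. -/
theorem norm_sq_determined_by_etaPar_and_theta (M0 Φ0 : ℝ) (hM0 : 0 < M0)
    (hΦ0 : 0 < Φ0) (g : V) (hg : g ≠ 0) :
    ∀ u : V, u ≠ 0 → etaPar M0 Φ0 g u ≠ 1 →
      ‖u‖ ^ 2 =
        Φ0 * (-1 + Real.sqrt (1 +
          4 * XiNorm M0 Φ0 g ^ 2 * cosTheta g u ^ 2 / (etaPar M0 Φ0 g u - 1) ^ 2)) := by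
  intro u hu hη
  have hn : ‖u‖ ≠ 0 := norm_ne_zero_iff.mpr hu
  have hG : ‖g‖ ≠ 0 := norm_ne_zero_iff.mpr hg
  have ha : ⟪g, u⟫ ≠ 0 := fun h => hη (by simp [etaPar, h])
  have hpos : 0 < ‖u‖ ^ 2 + 2 * Φ0 := by positivity
  have hs : Real.sqrt (‖u‖ ^ 2 + 2 * Φ0) ≠ 0 := (Real.sqrt_pos.mpr hpos).ne'
  have hsq : Real.sqrt (‖u‖ ^ 2 + 2 * Φ0) ^ 2 = ‖u‖ ^ 2 + 2 * Φ0 := Real.sq_sqrt hpos.le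
  have hquot : 4 * XiNorm M0 Φ0 g ^ 2 * cosTheta g u ^ 2 / (etaPar M0 Φ0 g u - 1) ^ 2 =
      Real.sqrt (‖u‖ ^ 2 + 2 * Φ0) ^ 2 * ‖u‖ ^ 2 / Φ0 ^ 2 := by
    simp only [XiNorm, cosTheta, etaPar, Hfun, real_inner_comm g u, add_sub_cancel_left]
    field_simp
    ring
  have hsquare : 1 + (‖u‖ ^ 2 + 2 * Φ0) * ‖u‖ ^ 2 / Φ0 ^ 2 = ((‖u‖ ^ 2 + Φ0) / Φ0) ^ 2 := by
    field_simp
    ring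
  rw [hquot, hsq, hsquare, Real.sqrt_sq (by positivity)]
  field_simp
  ring
end

section
/- Let φ : I → V be a C² solution of the flat cosmological equation on an open interval I. Then the cosmological energy E_φ(t) = (1/2)·‖φ'(t)‖² + Φ(φ(t)) satisfies the cosmological dissipation equation dE_φ/dt = −(√(2·E_φ(t))/M0)·‖φ'(t)‖² for all t ∈ I. -/
open scoped RealInnerProductSpace

/-- For a C² solution `φ` of the flat cosmological equation
`φ'' + (1/M0)·√(‖φ'‖² + 2Φ(φ))·φ' + ∇Φ(φ) = 0` on an open interval, the
cosmological energy `E_φ(t) = (1/2)‖φ'(t)‖² + Φ(φ(t))` satisfies the cosmological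
dissipation equation `dE_φ/dt = −(√(2E_φ)/M0)·‖φ'‖²`. -/
theorem cosmological_dissipation_equation
    {V : Type*} [NormedAddCommGroup V] [InnerProductSpace ℝ V] [FiniteDimensional ℝ V]
    (M0 : ℝ) (hM0 : 0 < M0) (Φ : V → ℝ) (hΦ : ContDiff ℝ (⊤ : ℕ∞) Φ) (hΦpos : ∀ x, 0 < Φ x)
    (a b : ℝ) (φ : ℝ → V) (hφ : ContDiffOn ℝ 2 φ (Set.Ioo a b))
    (heq : ∀ t ∈ Set.Ioo a b,
      deriv (deriv φ) t
        + ((1 / M0) * Real.sqrt (‖deriv φ t‖ ^ 2 + 2 * Φ (φ t))) • deriv φ t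
        + gradient Φ (φ t) = 0) :
    ∀ t ∈ Set.Ioo a b,
      HasDerivAt (fun s => (1 / 2) * ‖deriv φ s‖ ^ 2 + Φ (φ s))
        (-(Real.sqrt (2 * ((1 / 2) * ‖deriv φ t‖ ^ 2 + Φ (φ t))) / M0)
          * ‖deriv φ t‖ ^ 2) t := by
  intro t ht
  have hnhds : Set.Ioo a b ∈ nhds t := isOpen_Ioo.mem_nhds ht
  have hφ1 : HasDerivAt φ (deriv φ t) t :=
    ((hφ.contDiffAt hnhds).differentiableAt (by norm_num)).hasDerivAt
  have hφ2 : HasDerivAt (deriv φ) (deriv (deriv φ) t) t :=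
    (((hφ.deriv_of_isOpen isOpen_Ioo (m := 1) (by norm_num)).contDiffAt hnhds).differentiableAt
      (by norm_num)).hasDerivAt
  have hgrad : HasGradientAt Φ (gradient Φ (φ t)) (φ t) :=
    (hΦ.differentiable (by simp) (φ t)).hasGradientAt
  have hpot : HasDerivAt (fun s => Φ (φ s)) ⟪gradient Φ (φ t), deriv φ t⟫ t :=
    hgrad.hasFDerivAt.comp_hasDerivAt t hφ1
  have hE := (hφ2.norm_sq.const_mul (1 / 2)).add hpot
  refine hE.congr_deriv ?_
  have hinner := congrArg (fun v => ⟪deriv φ t, v⟫) (heq t ht)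
  simp only [inner_add_right, inner_smul_right, inner_zero_right,
    real_inner_self_eq_norm_sq] at hinner
  rw [real_inner_comm (deriv φ t) (gradient Φ (φ t)),
    show 2 * ((1 / 2) * ‖deriv φ t‖ ^ 2 + Φ (φ t)) = ‖deriv φ t‖ ^ 2 + 2 * Φ (φ t) by ring]
  linear_combination hinner
end

section
/- Let φ : I → V be a C² solution of the flat cosmological equation and let t ∈ I be a regular time, i.e. φ'(t) ≠ 0. Then the derivative of the speed satisfies (d/dt)‖φ'(t)‖ = −𝓗_φ(t)·‖φ'(t)‖ − ⟨∇Φ(φ(t)), φ'(t)⟩/‖φ'(t)‖, where 𝓗_φ(t) = (1/M0)·√(‖φ'(t)‖² + 2·Φ(φ(t))); equivalently, the rescaled tangential acceleration −(1/(𝓗_φ(t)·‖φ'(t)‖))·(d/dt)‖φ'(t)‖ of φ at time t equals 1 + ⟨∇Φ(φ(t)), φ'(t)⟩/(𝓗_φ(t)·‖φ'(t)‖²), the value of the second slow roll function on φ'(t). -/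
open scoped RealInnerProductSpace

variable {V : Type*} [NormedAddCommGroup V] [InnerProductSpace ℝ V] [FiniteDimensional ℝ V]

/-- The rescaled Hubble parameter of a curve:
`𝓗_φ(t) = (1/M0)·√(‖φ'(t)‖² + 2Φ(φ(t)))`. -/
noncomputable def HubbleParam (M0 : ℝ) (Φ : V → ℝ) (φ : ℝ → V) (t : ℝ) : ℝ :=
  (1 / M0) * Real.sqrt (‖deriv φ t‖ ^ 2 + 2 * Φ (φ t))

/-- For a C² solution `φ` of the flat cosmological equation and a regular time `t`
(i.e. `φ'(t) ≠ 0`), the derivative of the speed satisfies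
`(d/dt)‖φ'(t)‖ = −𝓗_φ(t)·‖φ'(t)‖ − ⟨∇Φ(φ(t)), φ'(t)⟩/‖φ'(t)‖`; equivalently, the
rescaled tangential acceleration `−(1/(𝓗_φ(t)·‖φ'(t)‖))·(d/dt)‖φ'(t)‖` equals
`1 + ⟨∇Φ(φ(t)), φ'(t)⟩/(𝓗_φ(t)·‖φ'(t)‖²)`, the value of the second slow roll
function on `φ'(t)`. -/
theorem speed_deriv_and_second_slow_roll (M0 : ℝ) (hM0 : 0 < M0)
    (Φ : V → ℝ) (hΦ : ContDiff ℝ (⊤ : ℕ∞) Φ) (hΦpos : ∀ x, 0 < Φ x)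
    (a b : ℝ) (φ : ℝ → V) (hφ : ContDiffOn ℝ 2 φ (Set.Ioo a b))
    (heq : ∀ t ∈ Set.Ioo a b,
      deriv (deriv φ) t
        + ((1 / M0) * Real.sqrt (‖deriv φ t‖ ^ 2 + 2 * Φ (φ t))) • deriv φ t
        + gradient Φ (φ t) = 0) :
    ∀ t ∈ Set.Ioo a b, deriv φ t ≠ 0 →
      HasDerivAt (fun s => ‖deriv φ s‖)
        (-(HubbleParam M0 Φ φ t) * ‖deriv φ t‖
          - ⟪gradient Φ (φ t), deriv φ t⟫ / ‖deriv φ t‖) t ∧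
      -(1 / (HubbleParam M0 Φ φ t * ‖deriv φ t‖)) *
          (-(HubbleParam M0 Φ φ t) * ‖deriv φ t‖
            - ⟪gradient Φ (φ t), deriv φ t⟫ / ‖deriv φ t‖) =
        1 + ⟪gradient Φ (φ t), deriv φ t⟫ / (HubbleParam M0 Φ φ t * ‖deriv φ t‖ ^ 2) := by
  intro t ht hne
  have hn : 0 < ‖deriv φ t‖ := norm_pos_iff.mpr hne
  have hH : 0 < HubbleParam M0 Φ φ t :=
    mul_pos (one_div_pos.mpr hM0) (Real.sqrt_pos.mpr (by have := hΦpos (φ t); positivity))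
  refine ⟨?_, by field_simp; ring⟩
  have hd : HasDerivAt (deriv φ) (deriv (deriv φ) t) t :=
    ((hφ.deriv_of_isOpen (m := 1) isOpen_Ioo (by norm_num)).differentiableOn one_ne_zero
      |>.differentiableAt (isOpen_Ioo.mem_nhds ht)).hasDerivAt
  have hacc : deriv (deriv φ) t = -(HubbleParam M0 Φ φ t • deriv φ t) - gradient Φ (φ t) := by
    rw [← sub_eq_zero, ← heq t ht, HubbleParam]
    abel
  have hs := hd.norm_sq.sqrt (pow_pos hn 2).ne'
  simp only [Real.sqrt_sq (norm_nonneg _)] at hs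
  convert hs using 1
  rw [hacc, inner_sub_right, inner_neg_right, real_inner_smul_right, real_inner_self_eq_norm_sq,
    real_inner_comm]
  field_simp
end

section
/- Let Φ : V → ℝ be C² and strictly positive, and let φ : I → V be a non-constant C² solution of the flat cosmological equation on an open interval I. Then the singular parameter set I_sing = {t ∈ I : φ'(t) = 0} is at most countable. -/
open scoped RealInnerProductSpace

/-- Two integral curves of a locally Lipschitz vector field on an open interval coincide as soon as
they agree at one time. -/
theorem LocallyLipschitz.eqOn_Ioo_of_hasDerivAt {E : Type*} [NormedAddCommGroup E]
    [NormedSpace ℝ E] {v : E → E} (hv : LocallyLipschitz v) {f g : ℝ → E} {a b t₀ : ℝ}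
    (hf : ∀ t ∈ Set.Ioo a b, HasDerivAt f (v (f t)) t)
    (hg : ∀ t ∈ Set.Ioo a b, HasDerivAt g (v (g t)) t)
    (ht₀ : t₀ ∈ Set.Ioo a b) (heq : f t₀ = g t₀) : Set.EqOn f g (Set.Ioo a b) := by
  intro t ht
  obtain ⟨c, hac, hc⟩ := exists_between (lt_min ht₀.1 ht.1)
  obtain ⟨d, hd, hdb⟩ := exists_between (max_lt ht₀.2 ht.2)
  obtain ⟨hc₀, hct⟩ := lt_min_iff.mp hc
  obtain ⟨hd₀, hdt⟩ := max_lt_iff.mp hd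
  have hsub : Set.Icc c d ⊆ Set.Ioo a b := Set.Icc_subset_Ioo hac hdb
  have hcomp : IsCompact (f '' Set.Icc c d ∪ g '' Set.Icc c d) :=
    (isCompact_Icc.image_of_continuousOn
      fun s hs ↦ (hf s (hsub hs)).continuousAt.continuousWithinAt).union
    (isCompact_Icc.image_of_continuousOn
      fun s hs ↦ (hg s (hsub hs)).continuousAt.continuousWithinAt)
  obtain ⟨K, hK⟩ :=
    LocallyLipschitzOn.exists_lipschitzOnWith_of_compact hcomp hv.locallyLipschitzOn
  refine ODE_solution_unique_of_mem_Ioo (v := fun _ ↦ v) (fun _ _ ↦ hK) ⟨hc₀, hd₀⟩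
    (fun s hs ↦ ?_) (fun s hs ↦ ?_) heq ⟨hct, hdt⟩
  · have hs' := Set.Ioo_subset_Icc_self hs
    exact ⟨hf s (hsub hs'), .inl (Set.mem_image_of_mem f hs')⟩
  · have hs' := Set.Ioo_subset_Icc_self hs
    exact ⟨hg s (hsub hs'), .inr (Set.mem_image_of_mem g hs')⟩

/-- The gradient of a `C^(n+1)` function is `C^n`. -/
theorem ContDiff.gradient {F : Type*} [NormedAddCommGroup F] [InnerProductSpace ℝ F]
    [CompleteSpace F] {f : F → ℝ} {m n : WithTop ℕ∞} (hf : ContDiff ℝ n f) (hmn : m + 1 ≤ n) :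
    ContDiff ℝ m (gradient f) :=
  (InnerProductSpace.toDual ℝ F).symm.contDiff.comp (hf.fderiv_right hmn)

/-- The zero set within `s` of a function with nonzero derivative at each of these zeros is
countable. -/
theorem countable_zeros_of_hasDerivAt_ne_zero {F : Type*} [NormedAddCommGroup F]
    [NormedSpace ℝ F] {f f' : ℝ → F} {s : Set ℝ}
    (h : ∀ t ∈ s, f t = 0 → HasDerivAt f (f' t) t ∧ f' t ≠ 0) :
    {t ∈ s | f t = 0}.Countable := by
  have : DiscreteTopology {t ∈ s | f t = 0} := by
    refine discreteTopology_of_noAccPts fun t ht hacc ↦ ?_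
    obtain ⟨hd, hne⟩ := h t ht.1 ht.2
    exact accPt_iff_frequently_nhdsNE.mp hacc
      ((hd.eventually_ne (c := 0) hne).mono fun x hx hxs ↦ hx hxs.2)
  exact Set.countable_coe_iff.mp (TopologicalSpace.separableSpace_iff_countable.mp inferInstance)

/-- The first-order vector field on `V × V` whose integral curves are the pairs `(φ, φ')` with `φ`
a solution of the flat cosmological equation. -/
noncomputable def cosmologicalField {V : Type*} [NormedAddCommGroup V] [InnerProductSpace ℝ V]
    [CompleteSpace V] (M0 : ℝ) (Φ : V → ℝ) (p : V × V) : V × V :=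
  (p.2, -(((1 / M0) * Real.sqrt (‖p.2‖ ^ 2 + 2 * Φ p.1)) • p.2 + gradient Φ p.1))

theorem contDiff_cosmologicalField {V : Type*} [NormedAddCommGroup V] [InnerProductSpace ℝ V]
    [CompleteSpace V] (M0 : ℝ) {Φ : V → ℝ} (hΦ : ContDiff ℝ 2 Φ) (hΦpos : ∀ x, 0 < Φ x) :
    ContDiff ℝ 1 (cosmologicalField M0 Φ) := by
  have hΦ₁ : ContDiff ℝ 1 fun p : V × V ↦ Φ p.1 := (hΦ.of_le one_le_two).comp contDiff_fst
  have hgrad : ContDiff ℝ 1 fun p : V × V ↦ gradient Φ p.1 :=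
    (hΦ.gradient (by norm_num [one_add_one_eq_two])).comp contDiff_fst
  have hsqrt : ContDiff ℝ 1 fun p : V × V ↦ Real.sqrt (‖p.2‖ ^ 2 + 2 * Φ p.1) :=
    ((contDiff_snd.norm_sq ℝ).add (contDiff_const.mul hΦ₁)).sqrt fun p ↦ by
      have := hΦpos p.1
      positivity
  exact contDiff_snd.prodMk (((contDiff_const.mul hsqrt).smul contDiff_snd).add hgrad).neg

/-- For a non-constant C² solution `φ` of the flat cosmological equation
`φ'' + (1/M0)·√(‖φ'‖² + 2Φ(φ))·φ' + ∇Φ(φ) = 0` on an open interval, the singular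
parameter set `{t : φ'(t) = 0}` is at most countable. -/
theorem singular_times_countable
    {V : Type*} [NormedAddCommGroup V] [InnerProductSpace ℝ V] [FiniteDimensional ℝ V]
    (M0 : ℝ) (hM0 : 0 < M0) (Φ : V → ℝ) (hΦ : ContDiff ℝ 2 Φ) (hΦpos : ∀ x, 0 < Φ x)
    (a b : ℝ) (φ : ℝ → V) (hφ : ContDiffOn ℝ 2 φ (Set.Ioo a b))
    (heq : ∀ t ∈ Set.Ioo a b,
      deriv (deriv φ) t
        + ((1 / M0) * Real.sqrt (‖deriv φ t‖ ^ 2 + 2 * Φ (φ t))) • deriv φ t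
        + gradient Φ (φ t) = 0)
    (hnonconst : ∃ t₁ ∈ Set.Ioo a b, ∃ t₂ ∈ Set.Ioo a b, φ t₁ ≠ φ t₂) :
    Set.Countable {t ∈ Set.Ioo a b | deriv φ t = 0} := by
  have hφ' : ContDiffOn ℝ 1 (deriv φ) (Set.Ioo a b) :=
    hφ.deriv_of_isOpen isOpen_Ioo (by norm_num [one_add_one_eq_two])
  have hd : ∀ t ∈ Set.Ioo a b, HasDerivAt φ (deriv φ t) t := fun t ht ↦
    ((hφ.differentiableOn (by norm_num)).differentiableAt (isOpen_Ioo.mem_nhds ht)).hasDerivAt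
  have hdd : ∀ t ∈ Set.Ioo a b, HasDerivAt (deriv φ) (deriv (deriv φ) t) t := fun t ht ↦
    ((hφ'.differentiableOn (by norm_num)).differentiableAt (isOpen_Ioo.mem_nhds ht)).hasDerivAt
  refine countable_zeros_of_hasDerivAt_ne_zero (f' := deriv (deriv φ))
    fun t₀ ht₀ hsing ↦ ⟨hdd t₀ ht₀, fun hzero ↦ ?_⟩
  have hcrit : gradient Φ (φ t₀) = 0 := by simpa [hsing, hzero] using heq t₀ ht₀
  have hcurve : ∀ t ∈ Set.Ioo a b, HasDerivAt (fun t ↦ (φ t, deriv φ t))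
      (cosmologicalField M0 Φ (φ t, deriv φ t)) t := fun t ht ↦ by
    have h := heq t ht
    rw [add_assoc] at h
    have hpair := (hd t ht).prodMk (hdd t ht)
    rwa [eq_neg_of_add_eq_zero_left h] at hpair
  have hconst : ∀ t ∈ Set.Ioo a b, HasDerivAt (fun _ ↦ (φ t₀, (0 : V)))
      (cosmologicalField M0 Φ (φ t₀, 0)) t := fun t _ ↦ by
    have hfield : cosmologicalField M0 Φ (φ t₀, 0) = 0 := by simp [cosmologicalField, hcrit]
    rw [hfield]
    exact hasDerivAt_const t _
  have hEq := (contDiff_cosmologicalField M0 hΦ hΦpos).locallyLipschitz.eqOn_Ioo_of_hasDerivAt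
    hcurve hconst ht₀ (by simp [hsing])
  obtain ⟨t₁, ht₁, t₂, ht₂, hne⟩ := hnonconst
  exact hne ((congrArg Prod.fst (hEq ht₁)).trans (congrArg Prod.fst (hEq ht₂)).symm)
end
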